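/- Let a ∈ ℝ, let f : (a, ∞) → ℝ be three times continuously differentiable with f'(x) > 0 for all x > a, and let t ∈ ℝ. Then the function F(x) := cos(f(x) − πt)/√(f'(x)) satisfies the Schrödinger equation F''(x) + V_f(x)·F(x) = 0 for all x ∈ (a, ∞). -/

import Mathlib

/-- The potential `V_f` associated with a function `f` via Liouville's transformation. -/
noncomputable def potential (f : ℝ → ℝ) (x : ℝ) : ℝ :=
  (deriv f x) ^ 2 + (1 / 2) * (deriv (deriv (deriv f)) x / deriv f x)
    - (3 / 4) * (deriv (deriv f) x / deriv f x) ^ 2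

theorem ContDiffOn.deriv_Ioi {a : ℝ} {f : ℝ → ℝ} {m n : WithTop ℕ∞}
    (hf : ContDiffOn ℝ n f (Set.Ioi a)) (hmn : m + 1 ≤ n) :
    ContDiffOn ℝ m (deriv f) (Set.Ioi a) :=
  hf.deriv_of_isOpen isOpen_Ioi hmn

theorem ContDiffOn.hasDerivAt_of_lt {a x : ℝ} {f : ℝ → ℝ} {n : WithTop ℕ∞}
    (hf : ContDiffOn ℝ n f (Set.Ioi a)) (hn : n ≠ 0) (hx : a < x) :
    HasDerivAt f (deriv f x) x :=
  ((hf.differentiableOn hn).differentiableAt (Ioi_mem_nhds hx)).hasDerivAt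

/-- First derivative of `cos (f - c) / √g` where `f' = g > 0`. -/
theorem hasDerivAt_cos_sub_div_sqrt {f g : ℝ → ℝ} {c g' x : ℝ} (hf : HasDerivAt f (g x) x)
    (hg : HasDerivAt g g' x) (hpos : 0 < g x) :
    HasDerivAt (fun y => Real.cos (f y - c) / √(g y))
      (-Real.sin (f x - c) * √(g x) - Real.cos (f x - c) * g' / (2 * √(g x) ^ 3)) x := by
  have hs : √(g x) ≠ 0 := (Real.sqrt_pos.2 hpos).ne'
  have hsq : √(g x) ^ 2 = g x := Real.sq_sqrt hpos.le
  refine (((hf.sub_const c).cos).fun_div (hg.sqrt hpos.ne') hs).congr_deriv ?_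
  generalize √(g x) = s at *
  rw [← hsq]
  field_simp

/-- Derivative of the expression in `hasDerivAt_cos_sub_div_sqrt`. -/
theorem hasDerivAt_deriv_cos_sub_div_sqrt {f g h : ℝ → ℝ} {c h' x : ℝ}
    (hf : HasDerivAt f (g x) x) (hg : HasDerivAt g (h x) x) (hh : HasDerivAt h h' x)
    (hpos : 0 < g x) :
    HasDerivAt
      (fun y => -Real.sin (f y - c) * √(g y) - Real.cos (f y - c) * h y / (2 * √(g y) ^ 3))
      (-(g x ^ 2 + (1 / 2) * (h' / g x) - (3 / 4) * (h x / g x) ^ 2) *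
        (Real.cos (f x - c) / √(g x))) x := by
  have hs : √(g x) ≠ 0 := (Real.sqrt_pos.2 hpos).ne'
  have hsq : √(g x) ^ 2 = g x := Real.sq_sqrt hpos.le
  have hu := hf.sub_const c
  have hsqrt := hg.sqrt hpos.ne'
  refine ((hu.sin.fun_neg.fun_mul hsqrt).fun_sub ((hu.cos.fun_mul hh).fun_div
    ((hsqrt.fun_pow 3).const_mul 2) (by positivity))).congr_deriv ?_
  generalize √(g x) = s at *
  rw [← hsq]
  field_simp
  ring

/-- Liouville's transformation: if `f` is `C³` on `(a, ∞)` with `f' > 0` there, then for any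
`t ∈ ℝ` the function `F(x) = cos(f(x) - πt)/√(f'(x))` satisfies the Schrödinger equation
`F'' + V_f · F = 0` on `(a, ∞)`. -/
theorem liouville_transformation (a t : ℝ) (f : ℝ → ℝ)
    (hf : ContDiffOn ℝ 3 f (Set.Ioi a))
    (hf' : ∀ x, a < x → 0 < deriv f x) :
    ∀ x, a < x →
      deriv (deriv (fun y => Real.cos (f y - Real.pi * t) / Real.sqrt (deriv f y))) x
        + potential f x * (Real.cos (f x - Real.pi * t) / Real.sqrt (deriv f x)) = 0 := by
  intro x hx
  have h1 : ContDiffOn ℝ 2 (deriv f) (Set.Ioi a) := hf.deriv_Ioi (by norm_num)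
  have h2 : ContDiffOn ℝ 1 (deriv (deriv f)) (Set.Ioi a) := h1.deriv_Ioi (by norm_num)
  have d0 {y : ℝ} (hy : a < y) := hf.hasDerivAt_of_lt (by norm_num) hy
  have d1 {y : ℝ} (hy : a < y) := h1.hasDerivAt_of_lt (by norm_num) hy
  have hfirst : deriv (fun y => Real.cos (f y - Real.pi * t) / √(deriv f y)) =ᶠ[nhds x]
      fun y => -Real.sin (f y - Real.pi * t) * √(deriv f y)
        - Real.cos (f y - Real.pi * t) * deriv (deriv f) y / (2 * √(deriv f y) ^ 3) := by
    filter_upwards [Ioi_mem_nhds hx] with y hy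
    exact (hasDerivAt_cos_sub_div_sqrt (d0 hy) (d1 hy) (hf' y hy)).deriv
  rw [hfirst.deriv_eq, (hasDerivAt_deriv_cos_sub_div_sqrt (d0 hx) (d1 hx)
    (h2.hasDerivAt_of_lt one_ne_zero hx) (hf' x hx)).deriv, potential]
  ring
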